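/- Consider the product space ({−1,1}^n, ν_α^{⊗n}) with 0 < α < 1/2, and let h(t) = φ(Φ^{−1}(t)). There exist universal constants C₁, C₂ > 0 such that for every n, every set A ⊆ {−1,1}^n, and every η ∈ (0,1), VAR(A, η) ≤ C₁·(∑_{i=1}^n I_i^h(A)²)^{C₂·ρ²}, where ρ = ρ(η, α) ∈ (0,1) is determined by η = P[W₁ < Φ^{−1}(α), W₁^ρ > Φ^{−1}(α)] / (α(1−α)) with (W₁, W₁^ρ) a bivariate normal vector with mean zero, unit variances, and correlation √(1−ρ²). -/

import Mathlib

open MeasureTheory ProbabilityTheory Filter Pointwise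

noncomputable section

/-- The standard Gaussian measure on `ℝ`. -/
def stdGaussian : Measure ℝ := gaussianReal 0 1

/-- The `n`-fold product of the standard Gaussian measure on `ℝⁿ`. -/
def gaussianPi (n : ℕ) : Measure (Fin n → ℝ) := Measure.pi fun _ => stdGaussian

/-- Lower Minkowski content of a set `S ⊆ ℝ` w.r.t. the standard Gaussian measure. -/
def minkContent (S : Set ℝ) : ℝ :=
  Filter.liminf
    (fun r : ℝ =>
      ((stdGaussian (S + Set.Icc (-r) r)).toReal - (stdGaussian S).toReal) / r)
    (nhdsWithin 0 (Set.Ioi 0))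

/-- The restriction of `A` along the fiber of `x` in the `i`-th direction. -/
def fiber {n : ℕ} (A : Set (Fin n → ℝ)) (i : Fin n) (x : Fin n → ℝ) : Set ℝ :=
  {y : ℝ | Function.update x i y ∈ A}

/-- The geometric influence of coordinate `i` on `A`. -/
def geomInfluence {n : ℕ} (A : Set (Fin n → ℝ)) (i : Fin n) : ℝ :=
  ∫ x, minkContent (fiber A i x) ∂(gaussianPi n)

/-- A set is increasing if its indicator is nondecreasing in each coordinate. -/
def IncreasingSet {n : ℕ} (A : Set (Fin n → ℝ)) : Prop :=
  ∀ ⦃x y : Fin n → ℝ⦄, x ≤ y → x ∈ A → y ∈ A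

end


noncomputable section

open Classical in
/-- The biased measure `ν_α = α·δ_{1} + (1−α)·δ_{−1}` on `{−1,1}`, modelled on `Bool`
with `true ↔ 1` and `false ↔ −1`. -/
def biasedBool (α : ℝ) : Measure Bool :=
  ENNReal.ofReal α • Measure.dirac true + ENNReal.ofReal (1 - α) • Measure.dirac false

/-- The product biased measure `ν_α^{⊗n}` on `{−1,1}ⁿ`. -/
def biasedPi (n : ℕ) (α : ℝ) : Measure (Fin n → Bool) :=
  Measure.pi fun _ => biasedBool α

/-- `VAR(B, η)` on the biased cube: `X ∼ ν_α^{⊗n}` and `X^η` is obtained from `X` by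
independently resampling each coordinate from `ν_α` with probability `η`. The triple
`(X, X', R)` of the original point, the fresh resamples, and the `Bernoulli(η)` resampling
indicators is distributed according to `ν_α^{⊗n} ⊗ ν_α^{⊗n} ⊗ ν_η^{⊗n}`. -/
def cubeNoisyVar (n : ℕ) (α η : ℝ) (B : Set (Fin n → Bool)) : ℝ :=
  (∫ z : (Fin n → Bool) × (Fin n → Bool) × (Fin n → Bool),
      B.indicator 1 z.1 * B.indicator 1 (fun i => if z.2.2 i then z.2.1 i else z.1 i)
      ∂((biasedPi n α).prod ((biasedPi n α).prod (biasedPi n η))))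
    - (∫ x, B.indicator 1 x ∂(biasedPi n α)) ^ 2

/-- The standard normal distribution function `Φ`. -/
def Phi (u : ℝ) : ℝ := (stdGaussian (Set.Iic u)).toReal

/-- `P[W₁ < t, W₁^ρ > t]` where `(W₁, W₁^ρ)` is a mean-zero bivariate normal vector with
unit variances and correlation `√(1−ρ²)`, realized as `W₁^ρ = √(1−ρ²)·W₁ + ρ·W₁'` for
independent standard Gaussians `W₁, W₁'`. -/
def crossProb (ρ t : ℝ) : ℝ :=
  ((stdGaussian.prod stdGaussian)
    {p : ℝ × ℝ | p.1 < t ∧ t < Real.sqrt (1 - ρ ^ 2) * p.1 + ρ * p.2}).toReal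

open Classical in
/-- The increasing map `ψ : ℝ → {−1,1}` with `ψ(u) = 1 ↔ Φ(u) ≥ 1 − α`, pushing `μ`
forward to `ν_α`. -/
def psi (α u : ℝ) : Bool := if 1 - α ≤ Phi u then true else false

end

noncomputable section

/-- The standard Gaussian density `φ(u) = (2π)^{−1/2}·e^{−u²/2}`. -/
def gphi (u : ℝ) : ℝ := (Real.sqrt (2 * Real.pi))⁻¹ * Real.exp (-(u ^ 2) / 2)

/-- The inverse `Φ⁻¹ : (0,1) → ℝ` of the standard normal distribution function. -/
def PhiInv (a : ℝ) : ℝ := sInf {u : ℝ | a ≤ Phi u}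

open Classical in
/-- The function `h(t) = φ(Φ⁻¹(t))` for `t ∈ (0,1)`, with `h(t) = 0` for `t ∉ (0,1)`
(in particular `h(0) = h(1) = 0`). -/
def hfun (a : ℝ) : ℝ := if a ≤ 0 ∨ 1 ≤ a then 0 else gphi (PhiInv a)

end

noncomputable section

/-- The `h`-influence of coordinate `i` on `A ⊆ {−1,1}ⁿ` w.r.t. the biased measure `ν_α`:
`I_i^h(A) = E_{x∼ν_α^{⊗n}}[h(ν_α(A_i^x))]`. -/
def hInfBool (n : ℕ) (α : ℝ) (A : Set (Fin n → Bool)) (i : Fin n) : ℝ :=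
  ∫ x, hfun ((biasedBool α {y : Bool | Function.update x i y ∈ A}).toReal)
    ∂(biasedPi n α)

end

noncomputable section

section Discrete

/-- weight of a point -/
def bW (α : ℝ) (n : ℕ) (x : Fin n → Bool) : ℝ := ∏ i, (if x i then α else 1 - α)

/-- expectation -/
def bE (α : ℝ) (n : ℕ) (f : (Fin n → Bool) → ℝ) : ℝ := ∑ x, bW α n x * f x

/-- average over the first coordinate -/
def bAvg (α : ℝ) {n : ℕ} (f : (Fin (n+1) → Bool) → ℝ) (x : Fin n → Bool) : ℝ :=
  α * f (Fin.cons true x : Fin (n+1) → Bool) + (1 - α) * f (Fin.cons false x : Fin (n+1) → Bool)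

/-- difference in the first coordinate -/
def bDif {n : ℕ} (f : (Fin (n+1) → Bool) → ℝ) (x : Fin n → Bool) : ℝ :=
  f (Fin.cons true x : Fin (n+1) → Bool) - f (Fin.cons false x : Fin (n+1) → Bool)

/-- centered coordinate -/
def bXi (α : ℝ) (b : Bool) : ℝ := if b then 1 - α else -α

/-- noise operator -/
def bT (α κ : ℝ) : (n : ℕ) → ((Fin n → Bool) → ℝ) → (Fin n → Bool) → ℝ
  | 0, f => f
  | n+1, f => fun x => bT α κ n (bAvg α f) (Fin.tail x) +
      κ * bXi α (x 0) * bT α κ n (bDif f) (Fin.tail x)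

/-- stability -/
def bQ (α τ : ℝ) : (n : ℕ) → ((Fin n → Bool) → ℝ) → ℝ
  | 0, f => f Fin.elim0 ^ 2
  | n+1, f => bQ α τ n (bAvg α f) + τ * (α * (1 - α)) * bQ α τ n (bDif f)

/-- L1 influence -/
def bInf (α : ℝ) (n : ℕ) (f : (Fin n → Bool) → ℝ) (i : Fin n) : ℝ :=
  bE α n (fun x => |f (Function.update x i true) - f (Function.update x i false)|)

variable {α : ℝ}

theorem bW_nonneg (h0 : 0 ≤ α) (h1 : α ≤ 1) (n : ℕ) (x : Fin n → Bool) : 0 ≤ bW α n x := by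
  unfold bW
  refine Finset.prod_nonneg fun i _ => ?_
  split_ifs <;> linarith

theorem bE_zero (f : (Fin 0 → Bool) → ℝ) : bE α 0 f = f Fin.elim0 := by
  unfold bE bW
  rw [Fintype.sum_unique]
  simp only [Finset.univ_eq_empty, Finset.prod_empty, one_mul]
  congr 1

theorem bE_succ (n : ℕ) (f : (Fin (n+1) → Bool) → ℝ) : bE α (n+1) f = bE α n (bAvg α f) := by
  unfold bE
  rw [← (Fin.consEquiv (fun _ : Fin (n+1) => Bool)).sum_comp, Fintype.sum_prod_type]
  simp only [Fintype.sum_bool, Fin.consEquiv, Equiv.coe_fn_mk]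
  rw [← Finset.sum_add_distrib]
  refine Finset.sum_congr rfl fun x _ => ?_
  simp [bW, bAvg, Fin.prod_univ_succ]
  ring

theorem bE_add {n : ℕ} (f g : (Fin n → Bool) → ℝ) :
    bE α n (fun x => f x + g x) = bE α n f + bE α n g := by
  simp [bE, mul_add, Finset.sum_add_distrib]

theorem bE_smul {n : ℕ} (c : ℝ) (f : (Fin n → Bool) → ℝ) :
    bE α n (fun x => c * f x) = c * bE α n f := by
  simp only [bE, Finset.mul_sum]
  exact Finset.sum_congr rfl fun x _ => by ring

theorem bE_mono (h0 : 0 ≤ α) (h1 : α ≤ 1) {n : ℕ} {f g : (Fin n → Bool) → ℝ}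
    (h : ∀ x, f x ≤ g x) : bE α n f ≤ bE α n g :=
  Finset.sum_le_sum fun x _ => mul_le_mul_of_nonneg_left (h x) (bW_nonneg h0 h1 n x)

theorem bE_nonneg (h0 : 0 ≤ α) (h1 : α ≤ 1) {n : ℕ} {f : (Fin n → Bool) → ℝ}
    (h : ∀ x, 0 ≤ f x) : 0 ≤ bE α n f :=
  Finset.sum_nonneg fun x _ => mul_nonneg (bW_nonneg h0 h1 n x) (h x)

theorem bE_one (n : ℕ) : bE α n (fun _ => 1) = 1 := by
  induction n with
  | zero => rw [bE_zero]
  | succ n ih =>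
    rw [bE_succ]
    have : (bAvg α (fun _ => 1) : (Fin n → Bool) → ℝ) = fun _ => 1 := by
      funext x; simp [bAvg]
    rw [this, ih]

theorem bE_cs (h0 : 0 ≤ α) (h1 : α ≤ 1) {n : ℕ} (f g : (Fin n → Bool) → ℝ) :
    bE α n (fun x => f x * g x) ^ 2 ≤ bE α n (fun x => f x ^ 2) * bE α n (fun x => g x ^ 2) := by
  unfold bE
  refine Finset.sum_sq_le_sum_mul_sum_of_sq_le_mul _
    (fun x _ => mul_nonneg (bW_nonneg h0 h1 n x) (sq_nonneg _))
    (fun x _ => mul_nonneg (bW_nonneg h0 h1 n x) (sq_nonneg _)) fun x _ => le_of_eq (by ring)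

theorem bAvg_mul {n : ℕ} (f g : (Fin (n+1) → Bool) → ℝ) :
    bAvg α (fun x => f x * g x) =
      fun x => bAvg α f x * bAvg α g x + (α * (1 - α)) * (bDif f x * bDif g x) := by
  funext x; simp only [bAvg, bDif]; ring

theorem bE_mul_succ {n : ℕ} (f g : (Fin (n+1) → Bool) → ℝ) :
    bE α (n+1) (fun x => f x * g x) = bE α n (fun x => bAvg α f x * bAvg α g x) +
      (α * (1 - α)) * bE α n (fun x => bDif f x * bDif g x) := by
  rw [bE_succ, bAvg_mul, bE_add, bE_smul]

theorem bE_sq_succ {n : ℕ} (f : (Fin (n+1) → Bool) → ℝ) :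
    bE α (n+1) (fun x => f x ^ 2) = bE α n (fun x => bAvg α f x ^ 2) +
      (α * (1 - α)) * bE α n (fun x => bDif f x ^ 2) := by
  simp only [pow_two]; exact bE_mul_succ f f

theorem bAvg_T (κ : ℝ) {n : ℕ} (f : (Fin (n+1) → Bool) → ℝ) :
    bAvg α (bT α κ (n+1) f) = bT α κ n (bAvg α f) := by
  funext x; simp [bAvg, bT, bXi]; ring

theorem bDif_T (κ : ℝ) {n : ℕ} (f : (Fin (n+1) → Bool) → ℝ) :
    bDif (bT α κ (n+1) f) = fun x => κ * bT α κ n (bDif f) x := by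
  funext x; simp [bDif, bT, bXi]; ring

theorem bAvg_smul (c : ℝ) {n : ℕ} (f : (Fin (n+1) → Bool) → ℝ) :
    bAvg α (fun x => c * f x) = fun x => c * bAvg α f x := by
  funext x; simp only [bAvg]; ring

theorem bDif_smul (c : ℝ) {n : ℕ} (f : (Fin (n+1) → Bool) → ℝ) :
    bDif (fun x => c * f x) = fun x => c * bDif f x := by
  funext x; simp only [bDif]; ring

theorem bT_smul (κ c : ℝ) : ∀ {n : ℕ} (f : (Fin n → Bool) → ℝ),
    bT α κ n (fun x => c * f x) = fun x => c * bT α κ n f x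
  | 0, f => rfl
  | n+1, f => by
    funext x
    simp only [bT, bAvg_smul, bDif_smul, bT_smul κ c (n := n)]
    ring

theorem bT_T (κ : ℝ) : ∀ {n : ℕ} (f : (Fin n → Bool) → ℝ),
    bT α κ n (bT α κ n f) = bT α (κ ^ 2) n f
  | 0, f => rfl
  | n+1, f => by
    funext x
    rw [bT, bAvg_T, bDif_T, bT_smul, bT_T, bT_T]
    simp only [bT]; ring

theorem bE_mul_T (τ : ℝ) : ∀ {n : ℕ} (f : (Fin n → Bool) → ℝ),
    bE α n (fun x => f x * bT α τ n f x) = bQ α τ n f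
  | 0, f => by rw [bE_zero]; simp only [bT, bQ]; ring
  | n+1, f => by
    rw [bE_mul_succ, bAvg_T, bDif_T, bQ, bE_mul_T τ]
    simp only [mul_left_comm _ τ]
    rw [bE_smul, bE_mul_T τ]; ring

theorem bE_T_sq (κ : ℝ) : ∀ {n : ℕ} (f : (Fin n → Bool) → ℝ),
    bE α n (fun x => bT α κ n f x ^ 2) = bQ α (κ ^ 2) n f
  | 0, f => by rw [bE_zero]; simp only [bT, bQ]
  | n+1, f => by
    rw [bE_sq_succ, bAvg_T, bDif_T, bQ, bE_T_sq κ]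
    simp only [mul_pow]
    rw [bE_smul, bE_T_sq κ]; ring

theorem bQ_one : ∀ {n : ℕ} (f : (Fin n → Bool) → ℝ),
    bQ α 1 n f = bE α n (fun x => f x ^ 2)
  | 0, f => by rw [bE_zero]; simp only [bQ]
  | n+1, f => by
    rw [bE_sq_succ, bQ, bQ_one, bQ_one]; ring

theorem bQ_zero : ∀ {n : ℕ} (f : (Fin n → Bool) → ℝ),
    bQ α 0 n f = (bE α n f) ^ 2
  | 0, f => by rw [bE_zero]; simp only [bQ]
  | n+1, f => by
    rw [bE_succ, bQ, bQ_zero]; ring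

theorem two_point (h0 : 0 < α) (h1 : α < 1 / 2) (A B : ℝ) :
    α * (A + α * (1 - α) * B) ^ 4 + (1 - α) * (A + α * (-α) * B) ^ 4 ≤
      (A ^ 2 + α * (1 - α) * B ^ 2) ^ 2 := by
  have key : 0 ≤ (2 - 6 * α ^ 2) * A ^ 2 - 4 * α ^ 3 * (1 - 2 * α) * A * B
      + (α * (1 - α) - α ^ 4 * (1 - 3 * (α * (1 - α)))) * B ^ 2 := by
    have e1 : (2 - 6 * α ^ 2) ≥ 1 / 2 := by nlinarith
    have e2 : α * (1 - α) - α ^ 4 * (1 - 3 * (α * (1 - α))) ≥ α / 4 := by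
      have : α ^ 4 * (1 - 3 * (α * (1 - α))) ≤ α ^ 4 := by
        have : 0 ≤ α ^ 4 * (3 * (α * (1 - α))) := by
          have : 0 ≤ 1 - α := by linarith
          positivity
        linarith
      have h3 : α ^ 3 ≤ 1 / 8 := by
        calc α ^ 3 ≤ (1/2) ^ 3 := by gcongr
          _ = 1/8 := by norm_num
      have h4 : α ^ 4 ≤ α * (1/8) := by
        have : α ^ 4 = α * α ^ 3 := by ring
        rw [this]; gcongr
      nlinarith
    -- middle: |4α³(1-2α)| ≤ 4 α³
    have e3 : (4 * α ^ 3 * (1 - 2 * α)) ^ 2 ≤ 4 * (1 / 2) * (α / 4) := by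
      have a1 : 4 * α ^ 3 * (1 - 2 * α) ≤ α * (1 / 2) := by
        have : α ^ 2 * (1 - 2 * α) ≤ 1 / 8 := by
          nlinarith [sq_nonneg (α - 1/3), sq_nonneg α]
        nlinarith
      have a0 : 0 ≤ 4 * α ^ 3 * (1 - 2 * α) := by
        have : 0 ≤ 1 - 2 * α := by linarith
        positivity
      nlinarith
    set m := 4 * α ^ 3 * (1 - 2 * α)
    have s1 : m * A * B ≤ 1 / 2 * A ^ 2 + α / 4 * B ^ 2 := by
      have : m ^ 2 * B ^ 2 ≤ 4 * (1 / 2) * (α / 4) * B ^ 2 :=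
        mul_le_mul_of_nonneg_right e3 (sq_nonneg B)
      nlinarith [sq_nonneg (A - m * B), sq_nonneg B]
    nlinarith [mul_le_mul_of_nonneg_right e1 (sq_nonneg A),
      mul_le_mul_of_nonneg_right e2 (sq_nonneg B)]
  have hs : 0 ≤ α * (1 - α) * B ^ 2 := by
    have : 0 ≤ 1 - α := by linarith
    positivity
  nlinarith [mul_nonneg hs key]

theorem bT_hyper (h0 : 0 < α) (h1 : α < 1 / 2) : ∀ {n : ℕ} (f : (Fin n → Bool) → ℝ),
    bE α n (fun x => bT α α n f x ^ 4) ≤ (bE α n (fun x => f x ^ 2)) ^ 2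
  | 0, f => by rw [bE_zero, bE_zero]; simp only [bT]; apply le_of_eq; ring
  | n+1, f => by
    have h0' := h0.le
    have h1' : α ≤ 1 := by linarith
    rw [bE_succ, bE_sq_succ]
    have i1 := bT_hyper h0 h1 (bAvg α f)
    have i2 := bT_hyper h0 h1 (bDif f)
    set A := bT α α n (bAvg α f)
    set B := bT α α n (bDif f)
    set a := bE α n (fun x => bAvg α f x ^ 2)
    set b := bE α n (fun x => bDif f x ^ 2)
    have ha : 0 ≤ a := bE_nonneg h0' h1' fun _ => sq_nonneg _
    have hb : 0 ≤ b := bE_nonneg h0' h1' fun _ => sq_nonneg _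
    have hσ : 0 ≤ α * (1 - α) := mul_nonneg h0' (by linarith)
    have step : bE α n (bAvg α (fun x => bT α α (n+1) f x ^ 4)) ≤
        bE α n (fun x => A x ^ 4 + ((2 * (α * (1 - α))) * (A x ^ 2 * B x ^ 2)
          + (α * (1 - α)) ^ 2 * B x ^ 4)) := by
      refine bE_mono h0' h1' fun x => ?_
      have := two_point h0 h1 (A x) (B x)
      simp only [bAvg, bT, bXi, Fin.cons_zero, Fin.tail_cons, if_true, Bool.false_eq_true, if_false]
      change α * (A x + α * (1 - α) * B x) ^ 4 + (1 - α) * (A x + α * (-α) * B x) ^ 4 ≤ _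
      nlinarith
    rw [bE_add, bE_add, bE_smul, bE_smul] at step
    have cs := bE_cs h0' h1' (fun x => A x ^ 2) (fun x => B x ^ 2)
    have e4 : ∀ y : ℝ, (y ^ 2) ^ 2 = y ^ 4 := fun y => by ring
    simp only [e4] at cs
    have hc : bE α n (fun x => A x ^ 2 * B x ^ 2) ≤ a * b := by
      refine abs_le_of_sq_le_sq' ?_ (by positivity) |>.2
      calc _ ≤ _ := cs
        _ ≤ a ^ 2 * b ^ 2 := by
            gcongr
            exact bE_nonneg h0' h1' fun _ => by positivity
        _ = _ := by ring
    calc _ ≤ _ := step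
      _ ≤ a ^ 2 + (2 * (α * (1 - α)) * (a * b) + (α * (1 - α)) ^ 2 * b ^ 2) := by
          gcongr
      _ = _ := by ring

theorem bInf_zero {n : ℕ} (f : (Fin (n+1) → Bool) → ℝ) :
    bInf α (n+1) f 0 = bE α n (fun x => |bDif f x|) := by
  unfold bInf
  rw [bE_succ]
  congr 1
  funext x
  simp only [bAvg, Fin.update_cons_zero, bDif]
  ring

theorem bInf_succ (h0 : 0 ≤ α) (h1 : α ≤ 1) {n : ℕ} (f : (Fin (n+1) → Bool) → ℝ) (i : Fin n) :
    bInf α n (bAvg α f) i ≤ bInf α (n+1) f i.succ := by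
  unfold bInf
  rw [bE_succ]
  refine bE_mono h0 h1 fun x => ?_
  simp only [bAvg, ← Fin.cons_update]
  set a := f (Fin.cons true (Function.update x i true) : Fin (n+1) → Bool)
  set b := f (Fin.cons false (Function.update x i true) : Fin (n+1) → Bool)
  set c := f (Fin.cons true (Function.update x i false) : Fin (n+1) → Bool)
  set d := f (Fin.cons false (Function.update x i false) : Fin (n+1) → Bool)
  have : α * a + (1 - α) * b - (α * c + (1 - α) * d) = α * (a - c) + (1 - α) * (b - d) := by ring
  rw [this]
  refine (abs_add_le _ _).trans ?_
  rw [abs_mul, abs_mul, abs_of_nonneg h0, abs_of_nonneg (by linarith : 0 ≤ 1 - α)]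

theorem bInf_nonneg (h0 : 0 ≤ α) (h1 : α ≤ 1) {n : ℕ} (f : (Fin n → Bool) → ℝ) (i : Fin n) :
    0 ≤ bInf α n f i := bE_nonneg h0 h1 fun _ => abs_nonneg _

theorem bQ_single (h0 : 0 < α) (h1 : α < 1 / 2) {n : ℕ} (g : (Fin n → Bool) → ℝ)
    {l : ℝ} (hl : 0 < l) :
    bQ α (α ^ 2) n g ≤ 2 * (l ^ 2 * bE α n (fun x => |g x|) ^ 2 +
      bE α n (fun x => g x ^ 2) / l ^ 2) := by
  have h0' := h0.le
  have h1' : α ≤ 1 := by linarith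
  set p := bE α n (fun x => |g x|) with hp
  set v := bE α n (fun x => g x ^ 2) with hv
  have hp0 : 0 ≤ p := bE_nonneg h0' h1' fun _ => abs_nonneg _
  have hv0 : 0 ≤ v := bE_nonneg h0' h1' fun _ => sq_nonneg _
  have hq := bE_T_sq (α := α) α g
  have hq2 := bE_mul_T (α := α) (α ^ 2) g
  set q := bQ α (α ^ 2) n g with hqd
  have hq0 : 0 ≤ q := by rw [← hq]; exact bE_nonneg h0' h1' fun _ => sq_nonneg _
  rcases hq0.eq_or_lt with hz | hpos
  · rw [← hz]; positivity
  set a := Real.sqrt q with ha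
  have ha0 : 0 < a := Real.sqrt_pos.2 hpos
  have haa : a ^ 2 = q := Real.sq_sqrt hq0
  have hyp := bT_hyper h0 h1 (bT α α n g)
  rw [bT_T, hq] at hyp
  set G := bT α (α ^ 2) n g
  have s1 : q ≤ bE α n (fun x => (l * a) * |g x| + (1 / (l * a)) * (|g x| * G x ^ 2)) := by
    rw [← hq2]
    refine bE_mono h0' h1' fun x => ?_
    have hla : 0 < l * a := by positivity
    have : |G x| ≤ l * a + (1 / (l * a)) * G x ^ 2 := by
      have e : l * a + (1 / (l * a)) * G x ^ 2 - |G x| =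
          (1 / (l * a)) * ((l * a - |G x|) ^ 2 + l * a * |G x|) := by
        field_simp
        rw [← sq_abs (G x)]; ring
      have : 0 ≤ (1 / (l * a)) * ((l * a - |G x|) ^ 2 + l * a * |G x|) := by positivity
      linarith
    calc g x * G x ≤ |g x * G x| := le_abs_self _
      _ = |g x| * |G x| := abs_mul _ _
      _ ≤ |g x| * (l * a + (1 / (l * a)) * G x ^ 2) := by gcongr
      _ = _ := by ring
  rw [bE_add, bE_smul, bE_smul] at s1
  have cs := bE_cs h0' h1' (fun x => |g x|) (fun x => G x ^ 2)
  have e4 : ∀ y : ℝ, (y ^ 2) ^ 2 = y ^ 4 := fun y => by ring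
  simp only [e4, sq_abs] at cs
  have hc : bE α n (fun x => |g x| * G x ^ 2) ≤ Real.sqrt v * q := by
    refine abs_le_of_sq_le_sq' ?_ (by positivity) |>.2
    calc _ ≤ _ := cs
      _ ≤ v * q ^ 2 := by gcongr
      _ = _ := by rw [mul_pow, Real.sq_sqrt hv0]
  have s2 : a ≤ l * p + Real.sqrt v / l := by
    have : a * a ≤ a * (l * p + Real.sqrt v / l) := by
      calc a * a = q := by rw [← haa]; ring
        _ ≤ _ := s1
        _ ≤ l * a * p + 1 / (l * a) * (Real.sqrt v * q) := by gcongr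
        _ = _ := by rw [← haa]; field_simp
    exact le_of_mul_le_mul_left this ha0
  calc q = a ^ 2 := haa.symm
    _ ≤ (l * p + Real.sqrt v / l) ^ 2 := by gcongr
    _ ≤ 2 * ((l * p) ^ 2 + (Real.sqrt v / l) ^ 2) := by nlinarith [sq_nonneg (l * p - Real.sqrt v / l)]
    _ = _ := by rw [mul_pow, div_pow, Real.sq_sqrt hv0]

theorem bQ_main (h0 : 0 < α) (h1 : α < 1 / 2) {l : ℝ} (hl : 0 < l) :
    ∀ {n : ℕ} (f : (Fin n → Bool) → ℝ),
    bQ α (α ^ 2) n f - bE α n f ^ 2 ≤ 2 * α ^ 2 * (l ^ 2 * ∑ i, bInf α n f i ^ 2 +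
      (bE α n (fun x => f x ^ 2) - bE α n f ^ 2) / l ^ 2)
  | 0, f => by simp [bE_zero, bQ]
  | n+1, f => by
    have h0' := h0.le
    have h1' : α ≤ 1 := by linarith
    have ih := bQ_main h0 h1 hl (bAvg α f)
    have hs := bQ_single h0 h1 (bDif f) hl
    rw [← bInf_zero] at hs
    rw [bQ, bE_sq_succ, bE_succ, Fin.sum_univ_succ]
    have hW : ∑ i, bInf α n (bAvg α f) i ^ 2 ≤ ∑ i : Fin n, bInf α (n+1) f i.succ ^ 2 :=
      Finset.sum_le_sum fun i _ => by
        have := bInf_succ h0' h1' f i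
        have := bInf_nonneg h0' h1' (bAvg α f) i
        gcongr
    set W' := ∑ i, bInf α n (bAvg α f) i ^ 2
    set W := ∑ i : Fin n, bInf α (n+1) f i.succ ^ 2
    set I := bInf α (n+1) f 0
    set v := bE α n (fun x => bDif f x ^ 2)
    set σ := α * (1 - α) with hσ
    have hσ0 : 0 ≤ σ := mul_nonneg h0' (by linarith)
    have hσ1 : σ ≤ 1 := by nlinarith
    calc _ = (bQ α (α ^ 2) n (bAvg α f) - bE α n (bAvg α f) ^ 2)
          + α ^ 2 * σ * bQ α (α ^ 2) n (bDif f) := by ring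
      _ ≤ 2 * α ^ 2 * (l ^ 2 * W + (bE α n (fun x => bAvg α f x ^ 2) - bE α n (bAvg α f) ^ 2) / l ^ 2)
          + α ^ 2 * σ * (2 * (l ^ 2 * I ^ 2 + v / l ^ 2)) := by
            refine add_le_add (ih.trans ?_) ?_ <;> gcongr
      _ ≤ 2 * α ^ 2 * (l ^ 2 * W + (bE α n (fun x => bAvg α f x ^ 2) - bE α n (bAvg α f) ^ 2) / l ^ 2)
          + 2 * α ^ 2 * (l ^ 2 * (1 * I ^ 2)  + σ * v / l ^ 2) := by
            have : σ * I ^ 2 ≤ 1 * I ^ 2 := by gcongr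
            have : α ^ 2 * l ^ 2 * (σ * I ^ 2) ≤ α ^ 2 * l ^ 2 * (1 * I ^ 2) := by gcongr
            ring_nf at this ⊢
            linarith
      _ = _ := by ring

theorem bQ_poly (h0 : 0 ≤ α) (h1 : α ≤ 1) : ∀ {n : ℕ} (f : (Fin n → Bool) → ℝ),
    ∃ w : ℕ → ℝ, (∀ k, 0 ≤ w k) ∧ ∀ τ, bQ α τ n f = ∑ k ∈ Finset.range (n+1), w k * τ ^ k
  | 0, f => ⟨fun _ => f Fin.elim0 ^ 2, fun _ => sq_nonneg _, fun τ => by simp [bQ]⟩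
  | n+1, f => by
    obtain ⟨w, hw, hw'⟩ := bQ_poly h0 h1 (bAvg α f)
    obtain ⟨u, hu, hu'⟩ := bQ_poly h0 h1 (bDif f)
    refine ⟨fun k => (if k < n + 1 then w k else 0) +
      (if k = 0 then 0 else (α * (1 - α)) * u (k - 1)), fun k => ?_, fun τ => ?_⟩
    · have h2 : 0 ≤ 1 - α := by linarith
      have := hw k
      have := hu (k - 1)
      refine add_nonneg ?_ ?_ <;> split_ifs <;> positivity
    · simp only [add_mul, Finset.sum_add_distrib]
      rw [Finset.sum_range_succ, Finset.sum_range_succ' (n := n+1)]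
      simp only [bQ, hw', hu', lt_irrefl, if_false, if_true, zero_mul, add_zero,
        Nat.succ_ne_zero, Nat.add_sub_cancel, Finset.mul_sum]
      congr 1
      · refine Finset.sum_congr rfl fun k hk => ?_
        rw [if_pos (Finset.mem_range.1 hk)]
      · refine Finset.sum_congr rfl fun k hk => by ring

/-- the main discrete estimate -/
theorem bQ_final (h0 : 0 < α) (h1 : α < 1 / 2) {n : ℕ} (f : (Fin n → Bool) → ℝ)
    (hf : ∀ x, f x ^ 2 ≤ 1) {θ τ : ℝ} (hθ0 : 0 < θ) (hθ1 : θ ≤ 1) (hτ0 : 0 ≤ τ)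
    (hτ : τ ≤ (α ^ 2) ^ θ) :
    bQ α τ n f - bE α n f ^ 2 ≤ (4 * α ^ 2 * Real.sqrt (∑ i, bInf α n f i ^ 2)) ^ θ := by
  have h0' := h0.le
  have h1' : α ≤ 1 := by linarith
  obtain ⟨w, hw, hw'⟩ := bQ_poly h0' h1' f
  have hw0 : bE α n f ^ 2 = w 0 := by
    rw [← bQ_zero, hw', Finset.sum_range_succ']; simp
  have hR : ∀ τ, bQ α τ n f - bE α n f ^ 2 = ∑ k ∈ Finset.range n, w (k+1) * τ ^ (k+1) := by
    intro τ; rw [hw0, hw', Finset.sum_range_succ']; simp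
  have hV : ∑ k ∈ Finset.range n, w (k+1) ≤ 1 := by
    have := hR 1
    simp only [one_pow, mul_one] at this
    rw [← this, bQ_one]
    have : bE α n (fun x => f x ^ 2) ≤ bE α n (fun _ => 1) := bE_mono h0' h1' hf
    rw [bE_one] at this
    nlinarith [sq_nonneg (bE α n f)]
  have hV0 : 0 ≤ ∑ k ∈ Finset.range n, w (k+1) := Finset.sum_nonneg fun k _ => hw _
  have hW0 : 0 ≤ ∑ i, bInf α n f i ^ 2 := Finset.sum_nonneg fun i _ => sq_nonneg _
  have hvar : bE α n (fun x => f x ^ 2) - bE α n f ^ 2 ≤ 1 := by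
    have := hR 1
    simp only [one_pow, mul_one] at this
    rw [← bQ_one, this]; exact hV
  set W := ∑ i, bInf α n f i ^ 2 with hWd
  have hbase : bQ α (α ^ 2) n f - bE α n f ^ 2 ≤ 4 * α ^ 2 * Real.sqrt W := by
    have hm : ∀ m : ℝ, 0 < m → bQ α (α ^ 2) n f - bE α n f ^ 2 ≤ 2 * α ^ 2 * (m * W + 1 / m) := by
      intro m hm
      have := bQ_main h0 h1 (Real.sqrt_pos.2 hm) f
      rw [Real.sq_sqrt hm.le] at this
      refine this.trans ?_
      gcongr
    rcases hW0.eq_or_lt with hz | hpos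
    · rw [← hz]
      simp only [Real.sqrt_zero, mul_zero]
      refine le_of_forall_pos_le_add fun ε hε => ?_
      have := hm (1 / ε) (by positivity)
      rw [← hz] at this
      have e : 2 * α ^ 2 * (1 / ε * 0 + 1 / (1 / ε)) = 2 * α ^ 2 * ε := by field_simp; ring
      rw [e] at this
      have h4 : α ^ 2 ≤ 1 / 4 := by nlinarith
      have := mul_le_mul_of_nonneg_right h4 hε.le
      linarith
    · have hs : 0 < Real.sqrt W := Real.sqrt_pos.2 hpos
      have := hm (1 / Real.sqrt W) (by positivity)
      refine this.trans (le_of_eq ?_)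
      have e : W = Real.sqrt W ^ 2 := (Real.sq_sqrt hW0).symm
      have : 1 / Real.sqrt W * W = Real.sqrt W := by
        nth_rw 2 [e]; field_simp
      rw [this]; simp; ring
  have hα2 : 0 ≤ α ^ 2 := sq_nonneg _
  calc bQ α τ n f - bE α n f ^ 2
      ≤ ∑ k ∈ Finset.range n, w (k+1) * ((α ^ 2) ^ (k+1)) ^ θ := by
        rw [hR]
        refine Finset.sum_le_sum fun k _ => mul_le_mul_of_nonneg_left ?_ (hw _)
        rw [← Real.rpow_natCast_mul hα2, mul_comm, Real.rpow_mul_natCast hα2]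
        gcongr
    _ ≤ (∑ k ∈ Finset.range n, w (k+1)) ^ (1 - θ) *
        (∑ k ∈ Finset.range n, w (k+1) * (α ^ 2) ^ (k+1)) ^ θ := by
        have := Real.inner_le_weight_mul_Lp_of_nonneg (Finset.range n) (p := θ⁻¹)
          ((one_le_inv₀ hθ0).2 hθ1) (fun k => w (k+1)) (fun k => ((α ^ 2) ^ (k+1)) ^ θ)
          (fun k => hw _) (fun k => by positivity)
        rw [inv_inv] at this
        refine this.trans (le_of_eq ?_)
        congr 2
        refine Finset.sum_congr rfl fun k _ => ?_
        rw [Real.rpow_rpow_inv (by positivity) hθ0.ne']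
    _ ≤ 1 * (4 * α ^ 2 * Real.sqrt W) ^ θ := by
        rw [← hR]
        have hp : 0 ≤ bQ α (α ^ 2) n f - bE α n f ^ 2 := by
          rw [hR]; exact Finset.sum_nonneg fun k _ => mul_nonneg (hw _) (by positivity)
        gcongr
        exact Real.rpow_le_one hV0 hV (by linarith)
    _ = _ := one_mul _

end Discrete

section Gauss

instance : IsProbabilityMeasure _root_.stdGaussian := by unfold _root_.stdGaussian; infer_instance

theorem std_noAtom (x : ℝ) : _root_.stdGaussian {x} = 0 := by
  have := nullSingletonClass_gaussianReal (μ := 0) (v := 1) one_ne_zero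
  unfold _root_.stdGaussian
  exact measure_singleton x

theorem std_toReal (s : Set ℝ) :
    (_root_.stdGaussian s).toReal = ∫ x in s, gaussianPDFReal 0 1 x := by
  unfold _root_.stdGaussian
  rw [gaussianReal_apply_eq_integral _ one_ne_zero, ENNReal.toReal_ofReal]
  exact integral_nonneg fun x => gaussianPDFReal_nonneg _ _ _

theorem pdf_eq (m x : ℝ) : gaussianPDFReal m 1 x = gphi (x - m) := by
  simp [gaussianPDFReal, gphi]

theorem Phi_mono {a b : ℝ} (h : a ≤ b) : Phi a ≤ Phi b := by
  unfold Phi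
  exact ENNReal.toReal_mono (measure_ne_top _ _) (measure_mono (Set.Iic_subset_Iic.2 h))

theorem Phi_Iio (a : ℝ) : (_root_.stdGaussian (Set.Iio a)).toReal = Phi a := by
  unfold Phi
  congr 1
  rw [← Set.Iio_union_right]
  refine le_antisymm (measure_mono Set.subset_union_left) ?_
  refine (measure_union_le _ _).trans ?_
  rw [std_noAtom, add_zero]

theorem Phi_neg (a : ℝ) : Phi (-a) = 1 - Phi a := by
  have h1 : _root_.stdGaussian (Set.Iic (-a)) = _root_.stdGaussian (Set.Ici a) := by
    have : _root_.stdGaussian = _root_.stdGaussian.map (fun x => -x) := by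
      unfold _root_.stdGaussian; rw [gaussianReal_map_neg, neg_zero]
    conv_lhs => rw [this]
    rw [Measure.map_apply measurable_neg measurableSet_Iic]
    congr 1
    ext x; simp
  have h2 : (_root_.stdGaussian (Set.Ici a)).toReal = 1 - (_root_.stdGaussian (Set.Iio a)).toReal := by
    have := prob_compl_eq_one_sub (μ := _root_.stdGaussian) (measurableSet_Iio (a := a))
    rw [Set.compl_Iio] at this
    rw [this, ENNReal.toReal_sub_of_le prob_le_one ENNReal.one_ne_top, ENNReal.toReal_one]
  rw [← Phi_Iio a, ← h2, ← h1]; rfl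

theorem gphi_pos (a : ℝ) : 0 < gphi a := by unfold gphi; positivity

theorem gphi_neg (a : ℝ) : gphi (-a) = gphi a := by simp [gphi]

theorem gphi_anti {x M : ℝ} (h1 : -M ≤ x) (h2 : x ≤ M) : gphi M ≤ gphi x := by
  unfold gphi
  have : x ^ 2 ≤ M ^ 2 := sq_le_sq' h1 h2
  gcongr

theorem interval_lower {a b M : ℝ} (hab : a ≤ b) (h1 : -M ≤ a) (h2 : b ≤ M) :
    (b - a) * gphi M ≤ (_root_.stdGaussian (Set.Ioo a b)).toReal := by
  rw [std_toReal]
  have : ∫ _ in Set.Ioo a b, gphi M ≤ ∫ x in Set.Ioo a b, gaussianPDFReal 0 1 x := by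
    refine setIntegral_mono_on ?_ (integrable_gaussianPDFReal 0 1).integrableOn measurableSet_Ioo ?_
    · exact integrableOn_const (by simp)
    · intro x hx
      rw [pdf_eq, sub_zero]
      exact gphi_anti (h1.trans hx.1.le) (hx.2.le.trans h2)
  simpa [hab, Measure.real] using this

theorem Phi_add_Ioo_le {a b : ℝ} (hab : a ≤ b) :
    Phi a + (_root_.stdGaussian (Set.Ioo a b)).toReal ≤ Phi b := by
  unfold Phi
  rw [← ENNReal.toReal_add (measure_ne_top _ _) (measure_ne_top _ _)]
  refine ENNReal.toReal_mono (measure_ne_top _ _) ?_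
  rw [← measure_union _ measurableSet_Ioo]
  · refine measure_mono ?_
    rintro x (hx | hx)
    · exact le_trans hx hab
    · exact hx.2.le
  · rw [Set.disjoint_left]
    intro x hx hx2
    exact absurd hx2.1 (not_lt.2 hx)

theorem Phi_strict {a b : ℝ} (hab : a < b) : Phi a < Phi b := by
  have h := Phi_add_Ioo_le hab.le
  have h2 := interval_lower (M := max |a| |b|) hab.le
    (by have := neg_abs_le a; have := le_max_left |a| |b|; linarith)
    ((le_abs_self b).trans (le_max_right _ _))
  have := mul_pos (sub_pos.2 hab) (gphi_pos (max |a| |b|))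
  linarith

theorem PhiInv_Phi (a : ℝ) : PhiInv (Phi a) = a := by
  unfold PhiInv
  have : {u : ℝ | Phi a ≤ Phi u} = Set.Ici a := by
    ext u
    simp only [Set.mem_ofPred_eq, Set.mem_Ici]
    exact ⟨fun h => not_lt.1 fun h' => absurd (Phi_strict h') (not_lt.2 h), Phi_mono⟩
  rw [this, csInf_Ici]

theorem Phi_nonneg (a : ℝ) : 0 ≤ Phi a := ENNReal.toReal_nonneg

theorem Phi_le_one (a : ℝ) : Phi a ≤ 1 := by
  have := Phi_neg a; have := Phi_nonneg (-a); linarith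

theorem Phi_shift {s b : ℝ} (hb : 0 ≤ b) :
    Phi (-(s + b)) ≤ Phi (-s) * Real.exp (-(s * b + b ^ 2 / 2)) := by
  have h1 : Phi (-(s + b)) = ∫ x in Set.Iic (-s), gaussianPDFReal b 1 x := by
    unfold Phi _root_.stdGaussian
    have : gaussianReal 0 1 = (gaussianReal b 1).map (fun x => x - b) := by
      rw [gaussianReal_map_sub_const, sub_self]
    rw [this, Measure.map_apply (by fun_prop) measurableSet_Iic]
    have : (fun x : ℝ => x - b) ⁻¹' Set.Iic (-(s + b)) = Set.Iic (-s) := by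
      ext x; simp only [Set.mem_preimage, Set.mem_Iic]; constructor <;> intro h <;> linarith
    rw [this, gaussianReal_apply_eq_integral _ one_ne_zero, ENNReal.toReal_ofReal]
    exact integral_nonneg fun x => gaussianPDFReal_nonneg _ _ _
  have h2 : Phi (-s) = ∫ x in Set.Iic (-s), gaussianPDFReal 0 1 x := std_toReal _
  rw [h1, h2, ← integral_mul_const]
  refine setIntegral_mono_on (integrable_gaussianPDFReal b 1).integrableOn
    ((integrable_gaussianPDFReal 0 1).integrableOn.mul_const _) measurableSet_Iic fun x hx => ?_
  rw [pdf_eq, pdf_eq]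
  unfold gphi
  rw [mul_assoc, ← Real.exp_add]
  have hx' : x ≤ -s := hx
  gcongr
  nlinarith

theorem Phi_le_exp {t : ℝ} (ht : t ≤ 0) : Phi t ≤ Real.exp (-(t ^ 2) / 2) := by
  have := Phi_shift (s := 0) (b := -t) (by linarith)
  simp only [zero_add, neg_neg, neg_zero, zero_mul, neg_sq] at this
  refine this.trans ?_
  rw [neg_div]
  have := Phi_le_one 0
  have := Real.exp_pos (-(t ^ 2 / 2))
  nlinarith

theorem gphi_const : Real.exp (-1) ≤ (Real.sqrt (2 * Real.pi))⁻¹ := by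
  rw [Real.exp_neg]
  refine inv_anti₀ (by positivity) ?_
  rw [Real.sqrt_le_left (by positivity)]
  have := Real.pi_lt_d2
  have := Real.exp_one_gt_d9
  nlinarith

theorem gphi_lower (x : ℝ) : Real.exp (-1 - x ^ 2 / 2) ≤ gphi x := by
  unfold gphi
  rw [sub_eq_add_neg, Real.exp_add, ← neg_div]
  gcongr
  exact gphi_const

theorem Phi_lower {s : ℝ} (hs : 1 ≤ s) : Real.exp (-(3 * s ^ 2)) ≤ Phi (-s) := by
  have h1 := Phi_add_Ioo_le (a := -(2 * s)) (b := -s) (by linarith)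
  have h2 := interval_lower (a := -(2 * s)) (b := -s) (M := 2 * s) (by linarith) (by linarith) (by linarith)
  have h3 := gphi_lower (2 * s)
  have h4 := Phi_nonneg (-(2 * s))
  have h5 : Real.exp (-(3 * s ^ 2)) ≤ Real.exp (-1 - (2 * s) ^ 2 / 2) :=
    Real.exp_le_exp.2 (by nlinarith)
  have h6 := gphi_pos (2 * s)
  nlinarith

theorem lin_map (c d : ℝ) : (_root_.stdGaussian.prod _root_.stdGaussian).map (fun p : ℝ × ℝ => c * p.1 + d * p.2) =
    gaussianReal 0 ⟨c ^ 2 + d ^ 2, by positivity⟩ := by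
  have h1 : (fun p : ℝ × ℝ => c * p.1 + d * p.2) =
      (fun p : ℝ × ℝ => p.1 + p.2) ∘ (Prod.map (fun x => c * x) (fun x => d * x)) := by
    funext p; simp
  rw [h1, ← Measure.map_map (by fun_prop) (by fun_prop),
    ← Measure.map_prod_map _ _ (by fun_prop) (by fun_prop)]
  unfold _root_.stdGaussian
  rw [gaussianReal_map_const_mul, gaussianReal_map_const_mul]
  change Measure.conv _ _ = _
  rw [gaussianReal_conv_gaussianReal]
  congr 1
  · ring
  · ext; simp; rfl

theorem lin_prob (c d u : ℝ) (h : 0 < c ^ 2 + d ^ 2) :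
    ((_root_.stdGaussian.prod _root_.stdGaussian) {p : ℝ × ℝ | c * p.1 + d * p.2 ≤ u}).toReal =
      Phi (u / Real.sqrt (c ^ 2 + d ^ 2)) := by
  set v := c ^ 2 + d ^ 2 with hv
  have hs : 0 < Real.sqrt v := Real.sqrt_pos.2 h
  have e1 : {p : ℝ × ℝ | c * p.1 + d * p.2 ≤ u} =
      (fun p : ℝ × ℝ => c * p.1 + d * p.2) ⁻¹' Set.Iic u := rfl
  rw [e1, ← Measure.map_apply (by fun_prop) measurableSet_Iic, lin_map]
  have e2 : gaussianReal 0 ⟨c ^ 2 + d ^ 2, by positivity⟩ =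
      _root_.stdGaussian.map (fun x => Real.sqrt v * x) := by
    unfold _root_.stdGaussian
    rw [gaussianReal_map_const_mul]
    congr 1
    · ring
    · ext
      simp only [NNReal.coe_mk, mul_one]
      exact (Real.sq_sqrt h.le).symm
  rw [e2, Measure.map_apply (by fun_prop) measurableSet_Iic]
  unfold Phi
  congr 2
  ext x
  simp only [Set.mem_preimage, Set.mem_Iic, le_div_iff₀ hs, mul_comm]

theorem crossProb_upper {ρ t : ℝ} (hρ : ρ ∈ Set.Ioo (0:ℝ) 1) (ht : t ≤ -1) :
    Phi t - crossProb ρ t ≤ Phi t * Phi t ^ (ρ ^ 2 / 24) := by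
  obtain ⟨hρ0, hρ1⟩ := hρ
  set r := Real.sqrt (1 - ρ ^ 2) with hr
  have hr0 : 0 ≤ r := Real.sqrt_nonneg _
  have hr2 : r ^ 2 = 1 - ρ ^ 2 := Real.sq_sqrt (by nlinarith)
  have hr1 : r ≤ 1 := by nlinarith
  set μ := _root_.stdGaussian.prod _root_.stdGaussian with hμ
  have hadd : Phi t ≤ crossProb ρ t + (μ {p : ℝ × ℝ | (1 + r) * p.1 + ρ * p.2 ≤ 2 * t}).toReal := by
    rw [← Phi_Iio]
    have e : _root_.stdGaussian (Set.Iio t) = μ (Set.Iio t ×ˢ Set.univ) := by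
      rw [hμ, Measure.prod_prod, measure_univ, mul_one]
    rw [e]
    unfold crossProb
    rw [← ENNReal.toReal_add (measure_ne_top _ _) (measure_ne_top _ _)]
    refine ENNReal.toReal_mono (by finiteness) ((measure_mono ?_).trans (measure_union_le _ _))
    rintro p ⟨hp, -⟩
    have hp' : p.1 < t := hp
    by_cases hc : t < r * p.1 + ρ * p.2
    · exact Or.inl ⟨hp', hc⟩
    · right
      simp only [Set.mem_ofPred_eq]
      nlinarith
  have hv : (1 + r) ^ 2 + ρ ^ 2 = 2 * (1 + r) := by nlinarith
  have hvp : 0 < (1 + r) ^ 2 + ρ ^ 2 := by positivity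
  rw [lin_prob _ _ _ hvp, hv] at hadd
  set q := Real.sqrt (2 * (1 + r)) with hq
  have hq0 : 0 < q := Real.sqrt_pos.2 (by positivity)
  have hq2 : q ^ 2 = 2 * (1 + r) := Real.sq_sqrt (by positivity)
  have hqle : q ≤ 2 := by nlinarith
  set κ := 2 / q with hκ
  have hκ1 : 1 ≤ κ := by rw [hκ, one_le_div hq0]; exact hqle
  have hκ2 : κ ^ 2 = 2 / (1 + r) := by
    rw [hκ, div_pow, hq2]; field_simp
  have hκ3 : ρ ^ 2 / 4 ≤ κ ^ 2 - 1 := by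
    rw [hκ2]
    have : 2 / (1 + r) - 1 = (1 - r) / (1 + r) := by field_simp; ring
    rw [this, le_div_iff₀ (by positivity)]
    nlinarith
  have hsh := Phi_shift (s := -t) (b := (κ - 1) * (-t)) (mul_nonneg (by linarith) (by linarith))
  have e1 : -(-t + (κ - 1) * (-t)) = 2 * t / q := by rw [hκ]; field_simp; ring
  have e2 : -t * ((κ - 1) * -t) + ((κ - 1) * -t) ^ 2 / 2 = (κ ^ 2 - 1) * t ^ 2 / 2 := by ring
  rw [e1, e2, neg_neg] at hsh
  have hlow := Phi_lower (s := -t) (by linarith)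
  rw [neg_neg, neg_sq] at hlow
  have hexp : Real.exp (-((κ ^ 2 - 1) * t ^ 2 / 2)) ≤ Phi t ^ (ρ ^ 2 / 24) := by
    calc _ ≤ Real.exp (-(3 * t ^ 2) * (ρ ^ 2 / 24)) := by
          refine Real.exp_le_exp.2 ?_
          nlinarith [mul_le_mul_of_nonneg_right hκ3 (sq_nonneg t)]
      _ = Real.exp (-(3 * t ^ 2)) ^ (ρ ^ 2 / 24) := Real.exp_mul _ _
      _ ≤ _ := Real.rpow_le_rpow (by positivity) hlow (by positivity)
  have := mul_le_mul_of_nonneg_left hexp (Phi_nonneg t)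
  linarith

theorem crossProb_lower {ρ t : ℝ} (hρ : ρ ∈ Set.Ioo (0:ℝ) 1) (ht : -1 ≤ t) (ht0 : t ≤ 0) :
    ρ * Real.exp (-6) ≤ crossProb ρ t := by
  obtain ⟨hρ0, hρ1⟩ := hρ
  set r := Real.sqrt (1 - ρ ^ 2) with hr
  have hr0 : 0 ≤ r := Real.sqrt_nonneg _
  have hr2 : r ^ 2 = 1 - ρ ^ 2 := Real.sq_sqrt (by nlinarith)
  have hr1 : r ≤ 1 := by nlinarith
  have h1 : ((_root_.stdGaussian.prod _root_.stdGaussian) (Set.Ioo (t - ρ) t ×ˢ Set.Ioi 1)).toReal ≤ crossProb ρ t := by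
    unfold crossProb
    refine ENNReal.toReal_mono (measure_ne_top _ _) (measure_mono ?_)
    rintro p ⟨⟨ha, hb⟩, hc⟩
    have hc' : 1 < p.2 := hc
    refine ⟨hb, ?_⟩
    change t < r * p.1 + ρ * p.2
    nlinarith
  rw [Measure.prod_prod, ENNReal.toReal_mul] at h1
  have h2 := interval_lower (a := t - ρ) (b := t) (M := 2) (by linarith) (by linarith) (by linarith)
  have h3 : Real.exp (-3) ≤ gphi 2 := by
    have := gphi_lower 2
    norm_num at this ⊢
    exact this
  have h4 : Real.exp (-3) ≤ (_root_.stdGaussian (Set.Ioi 1)).toReal := by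
    have a := Phi_lower (s := 1) le_rfl
    have b := prob_compl_eq_one_sub (μ := _root_.stdGaussian) (measurableSet_Iic (a := (1:ℝ)))
    rw [Set.compl_Iic] at b
    rw [b, ENNReal.toReal_sub_of_le prob_le_one ENNReal.one_ne_top, ENNReal.toReal_one]
    rw [Phi_neg] at a
    simpa [Phi] using a
  have e : Real.exp (-6) = Real.exp (-3) * Real.exp (-3) := by rw [← Real.exp_add]; norm_num
  have h5 : ρ * Real.exp (-3) ≤ (_root_.stdGaussian (Set.Ioo (t - ρ) t)).toReal := by
    have : t - (t - ρ) = ρ := by ring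
    rw [this] at h2
    nlinarith
  calc ρ * Real.exp (-6) = (ρ * Real.exp (-3)) * Real.exp (-3) := by rw [e]; ring
    _ ≤ _ := mul_le_mul h5 h4 (by positivity) ENNReal.toReal_nonneg
    _ ≤ _ := h1

/-- the key relation between `η` and `ρ` -/
theorem eta_bound {α ρ t η : ℝ} (h0 : 0 < α) (h1 : α < 1 / 2) (hρ : ρ ∈ Set.Ioo (0:ℝ) 1)
    (ht : Phi t = α) (hη : η = crossProb ρ t / (α * (1 - α))) :
    1 - η ≤ α ^ (Real.exp (-6) * ρ ^ 2) := by
  have ht0 : t ≤ 0 := by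
    by_contra h
    push Not at h
    have a := Phi_neg t
    have b := Phi_mono (show -t ≤ t by linarith)
    linarith
  have hσ : 0 < α * (1 - α) := mul_pos h0 (by linarith)
  have hρ0 := hρ.1
  have hρ1 := hρ.2
  have he : Real.exp (-6) ≤ 1 / 24 := by
    have : (24:ℝ) ≤ Real.exp 6 := by
      have h2 := Real.add_one_le_exp (5:ℝ)
      have e : Real.exp 6 = Real.exp 5 * Real.exp 1 := by rw [← Real.exp_add]; norm_num
      have := Real.exp_one_gt_d9
      have h3 := Real.exp_pos 5
      have e5 : Real.exp 5 = Real.exp 1 * Real.exp 1 * Real.exp 1 * Real.exp 1 * Real.exp 1 := by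
        simp only [← Real.exp_add]; norm_num
      have h6 : (6:ℝ) ≤ Real.exp 1 * Real.exp 1 := by nlinarith
      have h12 : (36:ℝ) ≤ (Real.exp 1 * Real.exp 1) * (Real.exp 1 * Real.exp 1) := by nlinarith
      nlinarith
    rw [Real.exp_neg, ← one_div]
    exact one_div_le_one_div_of_le (by norm_num) this
  rcases le_total t (-1) with hc | hc
  · have h := crossProb_upper hρ hc
    rw [ht] at h
    set x := α ^ (ρ ^ 2 / 24) with hx
    have hx1 : x ≤ 1 := Real.rpow_le_one h0.le (by linarith) (by positivity)
    have hx2 : x ≤ α ^ (Real.exp (-6) * ρ ^ 2) := by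
      refine Real.rpow_le_rpow_of_exponent_ge h0 (by linarith) ?_
      nlinarith [sq_nonneg ρ]
    refine le_trans ?_ hx2
    rw [hη, sub_le_iff_le_add, ← sub_le_iff_le_add', le_div_iff₀ hσ]
    nlinarith [mul_nonneg (mul_nonneg h0.le h0.le) (sub_nonneg.2 hx1)]
  · have h := crossProb_lower hρ hc ht0
    have hα : Real.exp (-3) ≤ α := by
      have := Phi_lower (s := 1) le_rfl
      have h2 := Phi_mono hc
      rw [ht] at h2
      norm_num at this
      linarith
    have hη' : 4 * (ρ * Real.exp (-6)) ≤ η := by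
      rw [hη, le_div_iff₀ hσ]
      have : α * (1 - α) ≤ 1 / 4 := by nlinarith [sq_nonneg (α - 1/2)]
      have hp : 0 < ρ * Real.exp (-6) := by positivity
      nlinarith
    have hρ2 : ρ ^ 2 ≤ ρ := by nlinarith
    calc 1 - η ≤ -3 * (Real.exp (-6) * ρ ^ 2) + 1 := by
          have := mul_le_mul_of_nonneg_right hρ2 (Real.exp_pos (-6)).le
          have : 0 < ρ * Real.exp (-6) := by positivity
          linarith
      _ ≤ Real.exp (-3 * (Real.exp (-6) * ρ ^ 2)) := Real.add_one_le_exp _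
      _ = Real.exp (-3) ^ (Real.exp (-6) * ρ ^ 2) := Real.exp_mul _ _
      _ ≤ _ := Real.rpow_le_rpow (by positivity) hα (by positivity)

theorem hfun_lower {α t : ℝ} (h0 : 0 < α) (h1 : α < 1 / 2) (ht : Phi t = α) :
    Real.exp (-1) * α ≤ hfun α ∧ Real.exp (-1) * α ≤ hfun (1 - α) := by
  have ht0 : t ≤ 0 := by
    by_contra h
    push Not at h
    have a := Phi_neg t
    have b := Phi_mono (show -t ≤ t by linarith)
    linarith
  have hg : Real.exp (-1) * α ≤ gphi t := by
    rw [← ht]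
    unfold gphi
    exact mul_le_mul gphi_const (Phi_le_exp ht0) (Phi_nonneg _) (by positivity)
  unfold hfun
  rw [if_neg (by push Not; constructor <;> linarith), if_neg (by push Not; constructor <;> linarith)]
  rw [← ht, ← Phi_neg, PhiInv_Phi, PhiInv_Phi, gphi_neg, ht]
  exact ⟨hg, hg⟩

end Gauss

section Link

theorem biasedBool_prob {α : ℝ} (h0 : 0 ≤ α) (h1 : α ≤ 1) : IsProbabilityMeasure (biasedBool α) := by
  refine ⟨?_⟩
  simp only [biasedBool, Measure.add_apply, Measure.smul_apply, measure_univ, smul_eq_mul, mul_one]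
  rw [← ENNReal.ofReal_add h0 (by linarith)]
  simp

theorem biasedBool_toReal {α : ℝ} (h0 : 0 ≤ α) (h1 : α ≤ 1) (s : Set Bool) :
    (biasedBool α s).toReal = α * s.indicator 1 true + (1 - α) * s.indicator 1 false := by
  have h2 : 0 ≤ 1 - α := by linarith
  simp only [biasedBool, Measure.add_apply, Measure.smul_apply, smul_eq_mul,
    Measure.dirac_apply]
  by_cases ht : true ∈ s <;> by_cases hf : false ∈ s <;>
    simp [ht, hf, h0, h2, ENNReal.toReal_add]

theorem integral_biasedPi {α : ℝ} (h0 : 0 ≤ α) (h1 : α ≤ 1) (n : ℕ) (f : (Fin n → Bool) → ℝ) :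
    ∫ x, f x ∂(biasedPi n α) = bE α n f := by
  have := biasedBool_prob h0 h1
  have : IsProbabilityMeasure (biasedPi n α) := by unfold biasedPi; infer_instance
  rw [integral_fintype .of_finite]
  unfold bE
  refine Finset.sum_congr rfl fun x _ => ?_
  rw [smul_eq_mul]
  congr 1
  unfold biasedPi Measure.real bW
  rw [Measure.pi_singleton, ENNReal.toReal_prod]
  refine Finset.prod_congr rfl fun i _ => ?_
  rw [biasedBool_toReal h0 h1]
  cases x i <;> simp

/-- mixing -/
def bMix {n : ℕ} (x y r : Fin n → Bool) : Fin n → Bool := fun i => if r i then y i else x i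

theorem bMix_cons {n : ℕ} (a b c : Bool) (x y r : Fin n → Bool) :
    bMix (Fin.cons a x : Fin (n+1) → Bool) (Fin.cons b y) (Fin.cons c r) =
      Fin.cons (if c then b else a) (bMix x y r) := by
  funext i
  refine Fin.cases ?_ (fun j => ?_) i <;> simp [bMix]

theorem bE_mix (α η : ℝ) : ∀ {n : ℕ} (g : (Fin n → Bool) → ℝ) (x : Fin n → Bool),
    bE α n (fun y => bE η n (fun r => g (bMix x y r))) = bT α (1 - η) n g x
  | 0, g, x => by
    rw [bE_zero, bE_zero, bT]
    congr 1
    exact Subsingleton.elim _ _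
  | n+1, g, x => by
    obtain ⟨b, x, rfl⟩ : ∃ b y, x = (Fin.cons b y : Fin (n+1) → Bool) :=
      ⟨x 0, Fin.tail x, (Fin.cons_self_tail x).symm⟩
    simp only [bT, Fin.tail_cons, Fin.cons_zero]
    rw [← bE_mix, ← bE_mix, bE_succ, ← bE_smul, ← bE_add]
    congr 1
    funext y
    simp only [bAvg, bE_succ]
    rw [← bE_smul, ← bE_smul, ← bE_smul, ← bE_add, ← bE_add]
    congr 1
    funext r
    simp only [bAvg, bMix_cons, bDif, bXi]
    cases b <;> simp <;> ring

theorem cubeNoisyVar_eq {α η : ℝ} (h0 : 0 ≤ α) (h1 : α ≤ 1) (g0 : 0 ≤ η) (g1 : η ≤ 1) (n : ℕ)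
    (A : Set (Fin n → Bool)) :
    cubeNoisyVar n α η A = bQ α (1 - η) n (A.indicator 1) - bE α n (A.indicator 1) ^ 2 := by
  have := biasedBool_prob h0 h1
  have : IsProbabilityMeasure (biasedPi n α) := by unfold biasedPi; infer_instance
  have := biasedBool_prob g0 g1
  have : IsProbabilityMeasure (biasedPi n η) := by unfold biasedPi; infer_instance
  unfold cubeNoisyVar
  rw [integral_biasedPi h0 h1, integral_prod _ .of_finite]
  congr 1
  rw [← bE_mul_T, integral_biasedPi h0 h1]
  congr 1
  funext x
  rw [integral_prod _ .of_finite, integral_biasedPi h0 h1, ← bE_mix, ← bE_smul]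
  congr 1
  funext y
  rw [integral_biasedPi g0 g1, ← bE_smul]
  rfl

theorem hInf_lower {α t : ℝ} (h0 : 0 < α) (h1 : α < 1 / 2) (ht : Phi t = α) (n : ℕ)
    (A : Set (Fin n → Bool)) (i : Fin n) :
    Real.exp (-1) * α * bInf α n (A.indicator 1) i ≤ hInfBool n α A i := by
  have h1' : α ≤ 1 := by linarith
  unfold hInfBool bInf
  rw [integral_biasedPi h0.le h1', ← bE_smul]
  refine bE_mono h0.le h1' fun x => ?_
  rw [biasedBool_toReal h0.le h1']
  obtain ⟨a, b⟩ := hfun_lower h0 h1 ht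
  have z0 : hfun 0 = 0 := by simp [hfun]
  have z1 : hfun 1 = 0 := by simp [hfun]
  by_cases c1 : Function.update x i true ∈ A <;> by_cases c2 : Function.update x i false ∈ A <;>
    simp [Set.indicator, c1, c2, z0, z1, a, b]

end Link

end

/-- **Theorem (quantitative BKS for the biased cube via `h`-influences).**
There are universal constants `C₁, C₂ > 0` such that for every `α ∈ (0, 1/2)`, every `n`,
every `A ⊆ {−1,1}ⁿ` and every `η ∈ (0,1)`,
`VAR(A, η) ≤ C₁·(∑ i, I_i^h(A)²)^(C₂·ρ²)`, where `ρ = ρ(η, α) ∈ (0,1)` is determined by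
`η = P[W₁ < Φ⁻¹(α), W₁^ρ > Φ⁻¹(α)] / (α(1−α))`, `(W₁, W₁^ρ)` being a mean-zero bivariate
normal vector with unit variances and correlation `√(1−ρ²)`. -/
theorem biased_cube_quantitative_BKS :
    ∃ C₁ C₂ : ℝ, 0 < C₁ ∧ 0 < C₂ ∧
      ∀ (α : ℝ), 0 < α → α < 1 / 2 →
        ∀ (n : ℕ) (A : Set (Fin n → Bool)) (η : ℝ), η ∈ Set.Ioo (0 : ℝ) 1 →
          ∀ (ρ : ℝ), ρ ∈ Set.Ioo (0 : ℝ) 1 →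
            ∀ (t : ℝ), Phi t = α →
              η = crossProb ρ t / (α * (1 - α)) →
              cubeNoisyVar n α η A ≤
                C₁ * (∑ i, hInfBool n α A i ^ 2) ^ (C₂ * ρ ^ 2) := by

  refine ⟨8, Real.exp (-6) / 4, by norm_num, by positivity, ?_⟩
  intro α h0 h1 n A η hη ρ hρ t ht hηeq
  have h1' : α ≤ 1 := by linarith
  have hρ0 := hρ.1
  have hρ1 := hρ.2
  have hb := eta_bound h0 h1 hρ ht hηeq
  rw [cubeNoisyVar_eq h0.le h1' hη.1.le hη.2.le]
  have he6 : Real.exp (-6) ≤ 1 := Real.exp_le_one_iff.2 (by norm_num)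
  have hρ2 : ρ ^ 2 ≤ 1 := by nlinarith
  have hρ2' : 0 < ρ ^ 2 := by positivity
  set θ := Real.exp (-6) * ρ ^ 2 / 2 with hθ
  have hθ0 : 0 < θ := by positivity
  have hθ1 : θ ≤ 1 := by
    have := mul_le_mul he6 hρ2 hρ2'.le (by norm_num)
    rw [hθ]; linarith
  have hτ : 1 - η ≤ (α ^ 2) ^ θ := by
    rw [← Real.rpow_natCast_mul h0.le]
    convert hb using 2
    rw [hθ]; push_cast; ring
  have hfin := bQ_final h0 h1 (A.indicator 1) (fun x => by
    by_cases hx : x ∈ A <;> simp [hx]) hθ0 hθ1 (by linarith [hη.2]) hτ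
  refine hfin.trans ?_
  set W := ∑ i, bInf α n (A.indicator 1) i ^ 2 with hW
  set H := ∑ i, hInfBool n α A i ^ 2 with hH
  have hW0 : 0 ≤ W := Finset.sum_nonneg fun i _ => sq_nonneg _
  have hH0 : 0 ≤ H := Finset.sum_nonneg fun i _ => sq_nonneg _
  have hWH : (Real.exp (-1) * α) ^ 2 * W ≤ H := by
    rw [hW, Finset.mul_sum]
    refine Finset.sum_le_sum fun i _ => ?_
    rw [← mul_pow]
    have := hInf_lower h0 h1 ht n A i
    have h2 := bInf_nonneg h0.le h1' (A.indicator 1) i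
    gcongr
  have hs : Real.exp (-1) * α * Real.sqrt W ≤ Real.sqrt H := by
    refine Real.le_sqrt_of_sq_le ?_
    rw [mul_pow, Real.sq_sqrt hW0]; exact hWH
  have hb2 : 4 * α ^ 2 * Real.sqrt W ≤ 8 * Real.sqrt H := by
    have e1 : Real.exp 1 * Real.exp (-1) = 1 := by rw [← Real.exp_add]; simp
    have e2 : Real.exp 1 ≤ 3 := by linarith [Real.exp_one_lt_d9]
    have hs0 := Real.sqrt_nonneg H
    have : α * Real.sqrt W ≤ 3 * Real.sqrt H := by
      calc α * Real.sqrt W = (Real.exp 1 * Real.exp (-1)) * α * Real.sqrt W := by rw [e1, one_mul]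
        _ = Real.exp 1 * (Real.exp (-1) * α * Real.sqrt W) := by ring
        _ ≤ 3 * Real.sqrt H := by gcongr
    have h3 : 0 ≤ α * Real.sqrt W := by positivity
    nlinarith
  calc (4 * α ^ 2 * Real.sqrt W) ^ θ ≤ (8 * Real.sqrt H) ^ θ := by gcongr
    _ = 8 ^ θ * Real.sqrt H ^ θ := Real.mul_rpow (by norm_num) (Real.sqrt_nonneg _)
    _ ≤ 8 ^ (1:ℝ) * Real.sqrt H ^ θ := by gcongr; norm_num
    _ = 8 * H ^ (Real.exp (-6) / 4 * ρ ^ 2) := by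
        rw [Real.rpow_one, Real.sqrt_eq_rpow, ← Real.rpow_mul hH0]
        congr 2
        rw [hθ]; ring
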